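/- Let α > 1 and consider the product weights γ_j = 1/j^{1+α}, i.e. γ_u = ∏_{j∈u} j^{−(1+α)}. Then for every dimension d ≥ 1 and every integer N ≥ 2, the weighted star discrepancy of the first N points of the d-dimensional Halton sequence satisfies D*_{N,γ}(H_{d,N}) ≤ (2e²/π)^{α/2} · (6·log N)^{−1/2} · N^{−1 + α·(6·log N)^{1/α}/log N}. -/

import Mathlib

open Finset Real

noncomputable section

/-- Radical inverse function in base `b`: if `n = ∑ nᵢ bⁱ` then `radInv b n = ∑ nᵢ b^{-i-1}`. -/
def radInv (b n : ℕ) : ℝ := ∑' i : ℕ, (((n / b ^ i) % b : ℕ) : ℝ) / (b : ℝ) ^ (i + 1)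

/-- `n`-th point of the `d`-dimensional Halton sequence; coordinate `j` (0-based)
uses the `(j+1)`-st prime (`Nat.nth Nat.Prime 0 = 2`). -/
def halton (d n : ℕ) : Fin d → ℝ := fun j => radInv (Nat.nth Nat.Prime j) n

open scoped Classical in
/-- Star discrepancy of the point set `P` of `N` points with coordinates indexed by `ι`:
`D*_N(P) = sup_{α ∈ [0,1]^ι} |#{n : P n ∈ [0,α)}/N − ∏ᵢ αᵢ|`. -/
def starDisc {ι : Type} [Fintype ι] (N : ℕ) (P : Fin N → ι → ℝ) : ℝ :=
  sSup {t : ℝ | ∃ α : ι → ℝ, (∀ i, 0 ≤ α i ∧ α i ≤ 1) ∧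
    t = |((Finset.univ.filter fun n : Fin N => ∀ i, 0 ≤ P n i ∧ P n i < α i).card : ℝ) / N
          - ∏ i, α i|}

/-- Star discrepancy of the projection of the first `N` points of the `d`-dimensional
Halton sequence onto the coordinates in `u`. -/
def haltonProjStarDisc (d N : ℕ) (u : Finset (Fin d)) : ℝ :=
  starDisc N fun n (i : u) => halton d n i.1

/-- Weighted star discrepancy, for product weights built from `γ : ℕ → ℝ` (1-based:
coordinate `j : Fin d` carries weight `γ (j+1)`), of the first `N` points of the
`d`-dimensional Halton sequence:
`max_{∅ ≠ u ⊆ [d]} (∏_{j ∈ u} γ_j) · D*_N(H_{d,N}(u))`. -/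
def wHaltonStarDisc (γ : ℕ → ℝ) (d N : ℕ) : ℝ :=
  sSup {t : ℝ | ∃ u : Finset (Fin d), u.Nonempty ∧
    t = (∏ j ∈ u, γ (j.1 + 1)) * haltonProjStarDisc d N u}

theorem radInv_summable {b : ℕ} (hb : 2 ≤ b) (n : ℕ) :
    Summable fun i : ℕ => (((n / b ^ i) % b : ℕ) : ℝ) / (b : ℝ) ^ (i + 1) := by
  refine summable_of_ne_finset_zero (s := Finset.range (n + 1)) fun i hi => ?_
  have hi' : n < i := by simpa using hi
  have : n < b ^ i := hi'.trans (Nat.lt_pow_self hb)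
  simp [Nat.div_eq_of_lt this]

theorem radInv_nonneg (b n : ℕ) : 0 ≤ radInv b n :=
  tsum_nonneg fun _ => by positivity

theorem radInv_eq {b : ℕ} (hb : 2 ≤ b) (n : ℕ) :
    radInv b n = ((n % b : ℕ) + radInv b (n / b)) / b := by
  have h := (radInv_summable hb n).tsum_eq_zero_add
  unfold radInv
  rw [h, add_div, ← tsum_div_const]
  congr 1
  · simp
  · refine tsum_congr fun i => ?_
    rw [Nat.div_div_eq_div_mul, ← pow_succ', div_div, ← pow_succ]

theorem radInv_lt_one {b : ℕ} (hb : 2 ≤ b) (n : ℕ) : radInv b n < 1 := by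
  induction n using Nat.strong_induction_on with
  | _ n ih =>
    rcases Nat.eq_zero_or_pos n with rfl | hn
    · simp [radInv]
    · have h1 := ih (n / b) (Nat.div_lt_self hn hb)
      have h2 : ((n % b : ℕ) : ℝ) + 1 ≤ b := by exact_mod_cast Nat.mod_lt n (by omega)
      rw [radInv_eq hb, div_lt_one (by positivity)]
      linarith

/-- Below `b ^ k`, the indicator of `radInv b n < a` is a sum of indicators of residue classes
modulo powers of `b`. -/
theorem exists_residue_decomposition {b : ℕ} (hb : 2 ≤ b) (k : ℕ) :
    ∀ a : ℝ, 0 ≤ a → a ≤ 1 → ∃ S : Multiset (ℕ × ℕ), S.card ≤ (b - 1) * k + 1 ∧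
      (∀ n < b ^ k, (if radInv b n < a then (1 : ℝ) else 0) =
        (S.map fun e => if n ≡ e.2 [MOD b ^ e.1] then (1 : ℝ) else 0).sum) ∧
      |a - (S.map fun e => 1 / ((b ^ e.1 : ℕ) : ℝ)).sum| ≤ 1 / (b : ℝ) ^ k := by
  have hb0 : (0 : ℝ) < b := by positivity
  induction k with
  | zero =>
    intro a ha0 ha1
    rcases ha0.eq_or_lt with rfl | ha
    · exact ⟨0, by simp, fun n _ => by simp [radInv_nonneg, not_lt], by simp⟩
    · refine ⟨{(0, 0)}, by simp, fun n hn => ?_, ?_⟩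
      · have : n = 0 := by simpa using hn
        subst this
        simp [radInv, ha, Nat.modEq_one]
      · simp only [Multiset.map_singleton, Multiset.sum_singleton, pow_zero, Nat.cast_one, div_one]
        rw [abs_le]
        constructor <;> linarith
  | succ k ih =>
    intro a ha0 ha1
    rcases ha1.eq_or_lt with rfl | ha
    · refine ⟨{(0, 0)}, by simp, fun n _ => ?_, ?_⟩
      · simp [radInv_lt_one hb, Nat.modEq_one]
      · simp
    · set c := ⌊(b : ℝ) * a⌋₊
      have hba : (0 : ℝ) ≤ b * a := by positivity
      have hc1 : (c : ℝ) ≤ b * a := Nat.floor_le hba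
      have hc2 : (b : ℝ) * a < c + 1 := Nat.lt_floor_add_one _
      have hcb : c < b := by
        have : (c : ℝ) < b := by nlinarith
        exact_mod_cast this
      obtain ⟨S, hS1, hS2, hS3⟩ := ih (b * a - c) (by linarith) (by linarith)
      refine ⟨(Multiset.range c).map (fun t => (1, t)) +
        S.map (fun e => (e.1 + 1, b * e.2 + c)), ?_, fun n hn => ?_, ?_⟩
      · simp only [Multiset.card_add, Multiset.card_map, Multiset.card_range]
        have : c ≤ b - 1 := by omega
        rw [mul_add]
        omega
      · have hnb : n / b < b ^ k := Nat.div_lt_of_lt_mul (by rwa [← pow_succ'])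
        have h1 : (((Multiset.range c).map fun t => (1, t)).map
            fun e : ℕ × ℕ => if n ≡ e.2 [MOD b ^ e.1] then (1 : ℝ) else 0).sum =
            if n % b < c then 1 else 0 := by
          rw [Multiset.map_map]
          change ∑ t ∈ Finset.range c, (if n ≡ t [MOD b ^ 1] then (1 : ℝ) else 0) = _
          have : ∀ t ∈ Finset.range c, (if n ≡ t [MOD b ^ 1] then (1 : ℝ) else 0) =
              if n % b = t then 1 else 0 := by
            intro t ht
            have ht' : t < c := by simpa using ht
            simp only [pow_one, Nat.ModEq, Nat.mod_eq_of_lt (ht'.trans hcb)]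
          rw [Finset.sum_congr rfl this, Finset.sum_ite_eq]
          simp
        have h2 : ((S.map fun e => (e.1 + 1, b * e.2 + c)).map
            fun e : ℕ × ℕ => if n ≡ e.2 [MOD b ^ e.1] then (1 : ℝ) else 0).sum =
            if n % b = c ∧ radInv b (n / b) < b * a - c then 1 else 0 := by
          have key : ∀ e : ℕ × ℕ, (n ≡ b * e.2 + c [MOD b ^ (e.1 + 1)]) ↔
              (n % b = c ∧ n / b ≡ e.2 [MOD b ^ e.1]) := by
            intro e
            have h3 : (n ≡ b * e.2 + c [MOD b ^ (e.1 + 1)]) → n % b = c := fun h => by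
              rw [pow_succ'] at h
              have := h.of_mul_right
              rwa [Nat.ModEq, Nat.mul_add_mod, Nat.mod_eq_of_lt hcb] at this
            rw [← and_iff_right_of_imp h3]
            refine and_congr_right fun h => ?_
            conv_lhs => rw [← Nat.div_add_mod n b, h, pow_succ']
            exact ⟨fun h' => (h'.add_right_cancel' c).mul_left_cancel' (by omega),
              fun h' => (h'.mul_left' b).add_right c⟩
          rw [Multiset.map_map]
          by_cases h3 : n % b = c
          · simp only [h3, true_and, hS2 _ hnb]
            congr 1
            refine Multiset.map_congr rfl fun e _ => ?_
            simp [key, h3]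
          · simp [key, h3]
        rw [Multiset.map_add, Multiset.sum_add, h1, h2]
        simp only [radInv_eq hb n, div_lt_iff₀ hb0]
        have hr0 := radInv_nonneg b (n / b)
        have hr1 := radInv_lt_one hb (n / b)
        rcases lt_trichotomy (n % b) c with h | h | h
        · have h' : ((n % b : ℕ) : ℝ) + 1 ≤ c := by exact_mod_cast h
          have h'' : ((n % b : ℕ) : ℝ) + radInv b (n / b) < a * b := by linarith
          simp [h, h.ne, h'']
        · have h' : ((n % b : ℕ) : ℝ) = c := by exact_mod_cast h
          have : ((n % b : ℕ) : ℝ) + radInv b (n / b) < a * b ↔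
              radInv b (n / b) < b * a - c := by
            rw [h']
            constructor <;> intro <;> linarith
          simp only [this]
          simp [h]
        · have h' : (c : ℝ) + 1 ≤ ((n % b : ℕ) : ℝ) := by exact_mod_cast h
          have h'' : ¬ ((n % b : ℕ) : ℝ) + radInv b (n / b) < a * b := by linarith
          simp [h.ne', h.not_gt, h'']
      · have h1 : (((Multiset.range c).map fun t => (1, t)).map
            fun e : ℕ × ℕ => 1 / ((b ^ e.1 : ℕ) : ℝ)).sum = c / b := by
          simp [div_eq_mul_inv]
        have h2 : ((S.map fun e => (e.1 + 1, b * e.2 + c)).map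
            fun e : ℕ × ℕ => 1 / ((b ^ e.1 : ℕ) : ℝ)).sum =
            (S.map fun e => 1 / ((b ^ e.1 : ℕ) : ℝ)).sum / b := by
          rw [Multiset.map_map, ← Multiset.sum_map_div]
          congr 1
          refine Multiset.map_congr rfl fun e _ => ?_
          simp [pow_succ, div_eq_mul_inv, mul_comm]
        rw [Multiset.map_add, Multiset.sum_add, h1, h2]
        have : a - (c / b + (S.map fun e => 1 / ((b ^ e.1 : ℕ) : ℝ)).sum / b) =
            (b * a - c - (S.map fun e => 1 / ((b ^ e.1 : ℕ) : ℝ)).sum) / b := by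
          field_simp
          ring
        rw [this, abs_div, abs_of_pos hb0, pow_succ, ← div_div]
        gcongr

theorem abs_card_modEq_sub_le (N : ℕ) {q : ℕ} (hq : 0 < q) (r : ℕ) :
    |∑ n ∈ Finset.range N, (if n ≡ r [MOD q] then (1 : ℝ) else 0) - N / q| ≤ 1 := by
  have h1 : ∑ n ∈ Finset.range N, (if n ≡ r [MOD q] then (1 : ℝ) else 0) =
      (N.count (· ≡ r [MOD q]) : ℝ) := by
    rw [Nat.count_eq_card_filter_range, Finset.sum_boole]
  rw [h1, Nat.count_modEq_card _ hq]
  have hq' : (0 : ℝ) < q := by exact_mod_cast hq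
  have h2 : (N : ℝ) = q * (N / q : ℕ) + (N % q : ℕ) := by
    exact_mod_cast (Nat.div_add_mod N q).symm
  have h3 : (N : ℝ) / q = (N / q : ℕ) + ((N % q : ℕ) : ℝ) / q := by
    conv_lhs => rw [h2]
    field_simp
  have h4 : ((N % q : ℕ) : ℝ) / q < 1 := by
    rw [div_lt_one hq']
    exact_mod_cast Nat.mod_lt N hq
  have h5 : 0 ≤ ((N % q : ℕ) : ℝ) / q := by positivity
  rw [h3, abs_le]
  push_cast
  split_ifs <;> constructor <;> simp <;> linarith

theorem abs_sum_sub_le_prod {ι : Type*} [DecidableEq ι] (N : ℕ) (b : ι → ℕ) (hb : ∀ i, 0 < b i)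
    (f : ι → ℕ → ℝ) (a C : ι → ℝ) (u : Finset ι)
    (hcop : ∀ i ∈ u, ∀ j ∈ u, i ≠ j → Nat.Coprime (b i) (b j))
    (ha0 : ∀ i ∈ u, 0 ≤ a i) (ha1 : ∀ i ∈ u, a i ≤ 1)
    (hS : ∀ i ∈ u, ∃ S : Multiset (ℕ × ℕ), (S.card : ℝ) + 1 ≤ C i ∧
      (∀ n < N, f i n =
        (S.map fun e => if n ≡ e.2 [MOD b i ^ e.1] then (1 : ℝ) else 0).sum) ∧
      N * |a i - (S.map fun e => 1 / ((b i ^ e.1 : ℕ) : ℝ)).sum| ≤ 1) :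
    ∀ q r : ℕ, 0 < q → (∀ i ∈ u, Nat.Coprime q (b i)) →
      |∑ n ∈ Finset.range N, (if n ≡ r [MOD q] then (1 : ℝ) else 0) * ∏ i ∈ u, f i n -
        N / q * ∏ i ∈ u, a i| ≤ ∏ i ∈ u, C i := by
  induction u using Finset.induction_on with
  | empty =>
    intro q r hq _
    simpa using abs_card_modEq_sub_le N hq r
  | insert i u hi ih =>
    intro q r hq hqc
    replace ih := ih (fun j hj l hl => hcop j (by simp [hj]) l (by simp [hl]))
      (fun j hj => ha0 j (by simp [hj])) (fun j hj => ha1 j (by simp [hj]))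
      (fun j hj => hS j (by simp [hj]))
    have hC1 : ∀ j ∈ u, 1 ≤ C j := fun j hj => by
      obtain ⟨S, hS1, _⟩ := hS j (by simp [hj])
      have : (0 : ℝ) ≤ S.card := by positivity
      linarith
    have haC : ∏ j ∈ u, a j ≤ ∏ j ∈ u, C j := Finset.prod_le_prod
      (fun j hj => ha0 j (by simp [hj]))
      fun j hj => (ha1 j (by simp [hj])).trans (hC1 j hj)
    have ha : 0 ≤ ∏ j ∈ u, a j := Finset.prod_nonneg fun j hj => ha0 j (by simp [hj])
    obtain ⟨S, hS1, hS2, hS3⟩ := hS i (by simp)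
    have hqi : Nat.Coprime q (b i) := hqc i (by simp)
    have hpiece : ∀ e : ℕ × ℕ,
        |∑ n ∈ Finset.range N, (if n ≡ r [MOD q] then (1 : ℝ) else 0) *
          (if n ≡ e.2 [MOD b i ^ e.1] then (1 : ℝ) else 0) * ∏ j ∈ u, f j n -
          N / q * (1 / ((b i ^ e.1 : ℕ) : ℝ)) * ∏ j ∈ u, a j| ≤ ∏ j ∈ u, C j := by
      intro e
      have hco : Nat.Coprime q (b i ^ e.1) := hqi.pow_right _
      obtain ⟨x, hx1, hx2⟩ := Nat.chineseRemainder hco r e.2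
      have h := ih (q * b i ^ e.1) x (Nat.mul_pos hq (Nat.pow_pos (hb i))) fun j hj =>
        Nat.Coprime.mul_left (hqc j (by simp [hj])) (Nat.Coprime.pow_left _
          (hcop i (by simp) j (by simp [hj]) (by rintro rfl; exact hi hj)))
      convert h using 3
      · refine Finset.sum_congr rfl fun n _ => ?_
        congr 1
        rw [ite_zero_mul_ite_zero, mul_one]
        refine if_congr ?_ rfl rfl
        rw [← Nat.modEq_and_modEq_iff_modEq_mul hco]
        exact and_congr ⟨fun h => h.trans hx1.symm, fun h => h.trans hx1⟩
          ⟨fun h => h.trans hx2.symm, fun h => h.trans hx2⟩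
      · push_cast
        rw [mul_one_div, div_div]
    have hsum : ∀ T : Multiset (ℕ × ℕ),
        |∑ n ∈ Finset.range N, (if n ≡ r [MOD q] then (1 : ℝ) else 0) *
          (T.map fun e => if n ≡ e.2 [MOD b i ^ e.1] then (1 : ℝ) else 0).sum * ∏ j ∈ u, f j n -
          N / q * (T.map fun e => 1 / ((b i ^ e.1 : ℕ) : ℝ)).sum * ∏ j ∈ u, a j| ≤
          T.card * ∏ j ∈ u, C j := by
      intro T
      induction T using Multiset.induction_on with
      | empty => simp
      | cons e T ihT =>
        simp only [Multiset.map_cons, Multiset.sum_cons, Multiset.card_cons, mul_add, add_mul,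
          Finset.sum_add_distrib]
        push_cast
        have := abs_add_le _ _ |>.trans (add_le_add (hpiece e) ihT)
        push_cast at this
        refine le_trans (le_of_eq ?_) (this.trans (le_of_eq ?_))
        · congr 1
          ring
        · ring
    have hq1 : (1 : ℝ) ≤ q := by exact_mod_cast hq
    have hrem : |N / q * ((S.map fun e => 1 / ((b i ^ e.1 : ℕ) : ℝ)).sum - a i) *
        ∏ j ∈ u, a j| ≤ ∏ j ∈ u, C j := by
      rw [abs_mul, abs_mul, abs_of_nonneg ha, abs_of_nonneg (by positivity), abs_sub_comm,
        div_mul_eq_mul_div]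
      calc _ ≤ 1 * ∏ j ∈ u, a j := by
            gcongr
            rw [div_le_one (by positivity)]
            exact hS3.trans hq1
        _ ≤ _ := by rwa [one_mul]
    have hC0 : 0 ≤ ∏ j ∈ u, C j := ha.trans haC
    calc _ = |(∑ n ∈ Finset.range N, (if n ≡ r [MOD q] then (1 : ℝ) else 0) *
          (S.map fun e => if n ≡ e.2 [MOD b i ^ e.1] then (1 : ℝ) else 0).sum * ∏ j ∈ u, f j n -
          N / q * (S.map fun e => 1 / ((b i ^ e.1 : ℕ) : ℝ)).sum * ∏ j ∈ u, a j) +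
          N / q * ((S.map fun e => 1 / ((b i ^ e.1 : ℕ) : ℝ)).sum - a i) * ∏ j ∈ u, a j| := by
          congr 1
          rw [Finset.prod_insert hi]
          have : ∀ n ∈ Finset.range N, (if n ≡ r [MOD q] then (1 : ℝ) else 0) *
              ∏ j ∈ insert i u, f j n = (if n ≡ r [MOD q] then (1 : ℝ) else 0) *
              (S.map fun e => if n ≡ e.2 [MOD b i ^ e.1] then (1 : ℝ) else 0).sum *
              ∏ j ∈ u, f j n := fun n hn => by
            rw [Finset.prod_insert hi, hS2 n (by simpa using hn), mul_assoc]
          rw [Finset.sum_congr rfl this]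
          ring
      _ ≤ S.card * ∏ j ∈ u, C j + ∏ j ∈ u, C j :=
          (abs_add_le _ _).trans (add_le_add (hsum S) hrem)
      _ = (S.card + 1) * ∏ j ∈ u, C j := by ring
      _ ≤ C i * ∏ j ∈ u, C j := by gcongr
      _ = _ := (Finset.prod_insert hi).symm

theorem le_three_mul_primeCounting_mul_log {n : ℕ} (hn : 2 ≤ n) :
    (n : ℝ) ≤ 3 * (Nat.primeCounting n * log n) := by
  have hl2 := Real.log_two_gt_d9
  have hl2' := Real.log_two_lt_d9
  have hlog : log 2 ≤ log n := Real.log_le_log (by norm_num) (by exact_mod_cast hn)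
  by_cases h6 : 6 ≤ n
  · have h6' : (6 : ℝ) ≤ n := by exact_mod_cast h6
    have h1 := Chebyshev.pi_ge n
    rw [div_le_iff₀ (by linarith)] at h1
    have h2 : log ((n + 1) / 8) ≤ (n + 1) / 8 - 1 := Real.log_le_sub_one_of_pos (by positivity)
    rw [Real.log_div (by positivity) (by norm_num),
      show (8 : ℝ) = 2 ^ 3 by norm_num, Real.log_pow] at h2
    push_cast at h2
    nlinarith
  · have h2 : Nat.primeCounting 2 = 1 := by decide
    have h3 : Nat.primeCounting 3 = 2 := by decide
    have h4 : Nat.primeCounting 4 = 2 := by decide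
    have h5 : Nat.primeCounting 5 = 3 := by decide
    interval_cases n <;> simp only [h2, h3, h4, h5] <;> push_cast at hlog ⊢ <;> linarith

theorem primeCounting_nth_prime (j : ℕ) :
    Nat.primeCounting (Nat.nth Nat.Prime j) = j + 1 :=
  Nat.count_nth_succ_of_infinite Nat.infinite_setOfPred_prime j

theorem digit_count_le_mul_log {N j : ℕ} (h : Nat.nth Nat.Prime j ≤ N) :
    (((Nat.nth Nat.Prime j - 1) * (Nat.log (Nat.nth Nat.Prime j) N + 1) + 1 : ℕ) : ℝ) + 1 ≤
      6 * (j + 1) * log N := by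
  have hb := Nat.prime_nth_prime j
  have hc := le_three_mul_primeCounting_mul_log hb.two_le
  rw [primeCounting_nth_prime] at hc
  generalize Nat.nth Nat.Prime j = b at *
  set K := Nat.log b N
  have hK1 : 1 ≤ K := Nat.log_pos hb.one_lt h
  have hN : N ≠ 0 := by have := hb.pos; omega
  have hpow : b ^ K ≤ N := Nat.pow_log_le_self b hN
  have hb0 : (0 : ℝ) < b := by exact_mod_cast hb.pos
  have hlog : K * log b ≤ log N := by
    rw [← Real.log_pow]
    exact Real.log_le_log (by positivity) (by exact_mod_cast hpow)
  have hK1' : (1 : ℝ) ≤ K := by exact_mod_cast hK1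
  push_cast [Nat.cast_sub hb.one_le] at hc ⊢
  calc ((b : ℝ) - 1) * (K + 1) + 1 + 1 ≤ 2 * (K * b) := by nlinarith
    _ ≤ 2 * (K * (3 * ((j + 1) * log b))) := by gcongr
    _ = 6 * (j + 1) * (K * log b) := by ring
    _ ≤ 6 * (j + 1) * log N := by gcongr

theorem haltonProjStarDisc_le {d N : ℕ} (hN : 2 ≤ N) (u : Finset (Fin d)) :
    haltonProjStarDisc d N u ≤ (∏ j ∈ u, 6 * ((j.1 : ℝ) + 1) * log N) / N := by
  have hN0 : (0 : ℝ) < N := by positivity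
  have hlog : log 2 ≤ log N := Real.log_le_log (by norm_num) (by exact_mod_cast hN)
  have hl2 := Real.log_two_gt_d9
  have hlog0 : 0 < log N := by linarith
  have hfac : ∀ j : Fin d, (1 : ℝ) ≤ 6 * ((j.1 : ℝ) + 1) * log N := fun j => by
    have : (0 : ℝ) ≤ j.1 := by positivity
    nlinarith
  refine Real.sSup_le ?_ (div_nonneg (Finset.prod_nonneg fun j _ => by linarith [hfac j]) hN0.le)
  rintro t ⟨a, ha, rfl⟩
  have ha0 : 0 ≤ ∏ i, a i := Finset.prod_nonneg fun i _ => (ha i).1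
  have ha1 : ∏ i, a i ≤ 1 := Finset.prod_le_one (fun i _ => (ha i).1) fun i _ => (ha i).2
  by_cases hbig : ∃ j ∈ u, N < Nat.nth Nat.Prime j.1
  · obtain ⟨j, hj, hNj⟩ := hbig
    have hcard : ∀ s : Finset (Fin N), (s.card : ℝ) / N ≤ 1 := fun s => by
      rw [div_le_one hN0]
      exact_mod_cast (Finset.card_le_univ s).trans_eq (by simp)
    have h1 : (N : ℝ) ≤ 6 * ((j.1 : ℝ) + 1) * log N := by
      have h2 := le_three_mul_primeCounting_mul_log hN
      have h3 : Nat.primeCounting N ≤ j.1 + 1 :=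
        (Nat.monotone_primeCounting hNj.le).trans_eq (primeCounting_nth_prime _)
      have h4 : (Nat.primeCounting N : ℝ) ≤ (j.1 : ℝ) + 1 := by exact_mod_cast h3
      have h5 : (Nat.primeCounting N : ℝ) * log N ≤ ((j.1 : ℝ) + 1) * log N := by gcongr
      have h6 : 0 ≤ ((j.1 : ℝ) + 1) * log N := by positivity
      linarith
    have h2 : (N : ℝ) ≤ ∏ j ∈ u, 6 * ((j.1 : ℝ) + 1) * log N :=
      by
      rw [← Finset.mul_prod_erase u _ hj]
      refine h1.trans (le_mul_of_one_le_right (by linarith [hfac j]) ?_)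
      exact Finset.one_le_prod fun i _ => hfac i
    refine le_trans ?_ ((one_le_div hN0).2 h2)
    rw [abs_le]
    refine ⟨?_, (sub_le_self _ ha0).trans (hcard _)⟩
    have : ∀ s : Finset (Fin N), (0 : ℝ) ≤ (s.card : ℝ) / N := fun s => by positivity
    linarith [this (Finset.univ.filter fun n : Fin N =>
      ∀ i : u, 0 ≤ halton d n i.1 ∧ halton d n i.1 < a i)]
  · push Not at hbig
    have hmain := abs_sum_sub_le_prod N (fun i : u => Nat.nth Nat.Prime i.1.1)
      (fun i => (Nat.prime_nth_prime _).pos)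
      (fun i n => if radInv (Nat.nth Nat.Prime i.1.1) n < a i then 1 else 0) a
      (fun i => 6 * ((i.1.1 : ℝ) + 1) * log N) Finset.univ
      (fun i _ j _ hij => (Nat.coprime_primes (Nat.prime_nth_prime _) (Nat.prime_nth_prime _)).2
        fun h => hij (Subtype.ext (Fin.ext
          (Nat.nth_injective Nat.infinite_setOfPred_prime h))))
      (fun i _ => (ha i).1) (fun i _ => (ha i).2)
      (fun i _ => by
        have hb := (Nat.prime_nth_prime i.1.1)
        have hlt : N < Nat.nth Nat.Prime i.1.1 ^ (Nat.log (Nat.nth Nat.Prime i.1.1) N + 1) :=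
          Nat.lt_pow_succ_log_self hb.one_lt N
        obtain ⟨S, h1, h2, h3⟩ := exists_residue_decomposition hb.two_le
          (Nat.log (Nat.nth Nat.Prime i.1.1) N + 1) (a i) (ha i).1 (ha i).2
        refine ⟨S, ?_, fun n hn => h2 n (hn.trans hlt), ?_⟩
        · exact le_trans (by gcongr) (digit_count_le_mul_log (hbig i.1 i.2))
        · refine (mul_le_mul_of_nonneg_left h3 hN0.le).trans ?_
          rw [mul_one_div]
          refine div_le_one_of_le₀ ?_ (by positivity)
          exact_mod_cast hlt.le)
      1 0 one_pos (fun i _ => Nat.coprime_one_left _)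
    have hsum : ((Finset.univ.filter fun n : Fin N =>
        ∀ i : u, 0 ≤ halton d n i.1 ∧ halton d n i.1 < a i).card : ℝ) =
        ∑ n ∈ Finset.range N, (if n ≡ 0 [MOD 1] then (1 : ℝ) else 0) *
          ∏ i : u, if radInv (Nat.nth Nat.Prime i.1.1) n < a i then 1 else 0 := by
      rw [← Fin.sum_univ_eq_sum_range (fun n => (if n ≡ 0 [MOD 1] then (1 : ℝ) else 0) *
          ∏ i : u, if radInv (Nat.nth Nat.Prime i.1.1) n < a i then (1 : ℝ) else 0),
        ← Finset.sum_boole]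
      refine Finset.sum_congr rfl fun n _ => ?_
      rw [if_pos (Nat.modEq_one), one_mul, Finset.prod_ite_zero]
      simp [halton, radInv_nonneg]
    rw [Nat.cast_one, div_one, ← hsum, Finset.prod_coe_sort u
      (fun j => 6 * ((j.1 : ℝ) + 1) * log N)] at hmain
    rw [le_div_iff₀ hN0, ← abs_of_pos hN0, ← abs_mul, abs_of_pos hN0, sub_mul,
      div_mul_cancel₀ _ hN0.ne', mul_comm _ (N : ℝ)]
    convert hmain

theorem factorial_card_le_prod_succ {d : ℕ} (u : Finset (Fin d)) :
    u.card.factorial ≤ ∏ j ∈ u, (j.1 + 1) := by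
  induction u using Finset.induction_on_max with
  | empty => simp
  | insert a s hs ih =>
    have ha : a ∉ s := fun h => (hs a h).false
    rw [Finset.card_insert_of_notMem ha, Finset.prod_insert ha, Nat.factorial_succ]
    refine Nat.mul_le_mul (Nat.succ_le_succ ?_) ih
    calc s.card ≤ (Finset.Iio a).card := Finset.card_le_card fun x hx => by simpa using hs x hx
      _ = a := by simp

theorem pow_div_factorial_le {y : ℝ} (hy : 0 < y) {s : ℕ} (hs : 1 ≤ s) :
    y ^ s / s.factorial ≤ √(2 * exp 1 ^ 2 / π) * (√y)⁻¹ * exp y := by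
  have hs0 : (0 : ℝ) < s := by exact_mod_cast hs
  have hst := Stirling.le_factorial_stirling s
  obtain ⟨t, ht, rfl⟩ : ∃ t : ℝ, 0 < t ∧ y = t * s := ⟨y / s, by positivity, by field_simp⟩
  have hpos : 0 < √(2 * π * s) * (s / exp 1) ^ s := by positivity
  have hbase : t * exp (1 - t) ≤ 1 := by
    have h1 := Real.add_one_le_exp (t - 1)
    rw [show 1 - t = -(t - 1) by ring, Real.exp_neg]
    rw [← div_eq_mul_inv, div_le_one (by positivity)]
    linarith
  have hpow : (t * exp (1 - t)) ^ s ≤ t * exp (1 - t) := pow_le_of_le_one (by positivity) hbase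
    (by omega)
  have ht32 : √t * (t * exp (1 - t)) ≤ 2 * exp 1 := by
    have h1 := Real.quadratic_le_exp_of_nonneg ht.le
    have h2 : √t * t ≤ (t + t ^ 2) / 2 := by
      nlinarith [Real.sq_sqrt ht.le, mul_nonneg ht.le (sq_nonneg (√t - 1))]
    rw [Real.exp_sub, mul_div_assoc', mul_div_assoc', div_le_iff₀ (by positivity)]
    have : √t * t ≤ 2 * exp t := by nlinarith [Real.exp_pos t]
    nlinarith [Real.exp_pos 1]
  have hkey : √t * (t * exp (1 - t)) ^ s ≤ 2 * exp 1 := le_trans (by gcongr) ht32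
  have hc : √(2 * exp 1 ^ 2 / π) * √(2 * π) = 2 * exp 1 := by
    rw [← Real.sqrt_mul (by positivity), show 2 * exp 1 ^ 2 / π * (2 * π) = (2 * exp 1) ^ 2 by
      field_simp, Real.sqrt_sq (by positivity)]
  have hexp : (t * exp (1 - t)) ^ s * exp (t * s) = t ^ s * exp 1 ^ s := by
    rw [mul_pow, ← Real.exp_nat_mul, ← Real.exp_nat_mul, mul_assoc, ← Real.exp_add]
    congr 2
    ring
  calc (t * s) ^ s / s.factorial ≤ (t * s) ^ s / (√(2 * π * s) * (s / exp 1) ^ s) := by gcongr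
    _ = (t ^ s * exp 1 ^ s) / (√(2 * π) * √s) := by
        rw [Real.sqrt_mul (by positivity), mul_pow, div_pow]
        field_simp
    _ = (√t * (t * exp (1 - t)) ^ s) * (exp (t * s) / (√(2 * π) * (√t * √s))) := by
        rw [← hexp]
        field_simp
    _ ≤ (2 * exp 1) * (exp (t * s) / (√(2 * π) * (√t * √s))) := by gcongr
    _ = _ := by
        rw [← hc, Real.sqrt_mul ht.le]
        field_simp

/-- For the product weights `γ_j = 1/j^{1+α}` with `α > 1`:
`D*_{N,γ}(H_{d,N}) ≤ (2e²/π)^{α/2} · (6 log N)^{−1/2} · N^{−1+α(6 log N)^{1/α}/log N}`. -/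
theorem halton_weighted_star_disc_polynomial_weights_bound (α : ℝ) (hα : 1 < α) :
    ∀ d : ℕ, 1 ≤ d → ∀ N : ℕ, 2 ≤ N →
      wHaltonStarDisc (fun j : ℕ => 1 / (j : ℝ) ^ (1 + α)) d N ≤
        (2 * Real.exp 1 ^ 2 / Real.pi) ^ (α / 2) *
          (6 * Real.log N) ^ (-(1 : ℝ) / 2) *
          (N : ℝ) ^ (-1 + α * (6 * Real.log N) ^ (1 / α) / Real.log N) := by
  intro d _ N hN
  have hN0 : (0 : ℝ) < N := by positivity
  have hL : 0 < log N := Real.log_pos (by exact_mod_cast hN)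
  have hα0 : 0 < α := by linarith
  set y : ℝ := (6 * log N) ^ (1 / α) with hy
  have hy0 : 0 < y := by positivity
  have hyα : y ^ α = 6 * log N := by
    rw [hy, ← Real.rpow_mul (by positivity), one_div_mul_cancel hα0.ne', Real.rpow_one]
  have hrhs : (2 * exp 1 ^ 2 / π) ^ (α / 2) * (6 * log N) ^ (-(1 : ℝ) / 2) *
      (N : ℝ) ^ (-1 + α * y / log N) =
      (√(2 * exp 1 ^ 2 / π) * (√y)⁻¹ * exp y) ^ α / N := by
    have hc : (√(2 * exp 1 ^ 2 / π)) ^ α = (2 * exp 1 ^ 2 / π) ^ (α / 2) := by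
      rw [Real.sqrt_eq_rpow, ← Real.rpow_mul (by positivity), one_div_mul_eq_div]
    have hy2 : (√y)⁻¹ ^ α = (6 * log N) ^ (-(1 : ℝ) / 2) := by
      rw [← hyα, ← Real.rpow_mul hy0.le, Real.inv_rpow (by positivity), Real.sqrt_eq_rpow,
        ← Real.rpow_mul hy0.le, ← Real.rpow_neg hy0.le]
      congr 1
      ring
    rw [Real.mul_rpow (z := α) (by positivity) (by positivity),
      Real.mul_rpow (z := α) (by positivity) (by positivity), hc, hy2, ← Real.exp_mul,
      Real.rpow_add hN0, Real.rpow_neg_one, Real.rpow_def_of_pos hN0 (α * y / log N),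
      mul_div_cancel₀ _ hL.ne', mul_comm y α]
    ring
  rw [hrhs]
  refine Real.sSup_le ?_ (by positivity)
  rintro t ⟨u, hu, rfl⟩
  have hγ : 0 ≤ ∏ j ∈ u, 1 / ((j.1 + 1 : ℕ) : ℝ) ^ (1 + α) :=
    Finset.prod_nonneg fun j _ => by positivity
  refine (mul_le_mul_of_nonneg_left (haltonProjStarDisc_le hN u) hγ).trans ?_
  rw [mul_div_assoc']
  gcongr
  rw [← Finset.prod_mul_distrib]
  have hterm : ∀ j ∈ u, 1 / ((j.1 + 1 : ℕ) : ℝ) ^ (1 + α) * (6 * ((j.1 : ℝ) + 1) * log N) =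
      (y / ((j.1 + 1 : ℕ) : ℝ)) ^ α := fun j _ => by
    have hj : (0 : ℝ) < (j.1 : ℝ) + 1 := by positivity
    push_cast
    rw [Real.div_rpow hy0.le hj.le, hyα, Real.rpow_add hj, Real.rpow_one]
    field_simp
  rw [Finset.prod_congr rfl hterm, Real.finsetProd_rpow _ _ fun j _ => by positivity]
  refine Real.rpow_le_rpow (Finset.prod_nonneg fun j _ => by positivity) ?_ hα0.le
  refine le_trans ?_ (pow_div_factorial_le hy0 (Finset.card_pos.2 hu))
  rw [Finset.prod_div_distrib, Finset.prod_const]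
  gcongr
  exact_mod_cast factorial_card_le_prod_succ u
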